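/- (Theorem 2, leader-follower adaptive guaranteed-performance consensualization.) Let N ≥ 2, d, p be positive integers, A ∈ ℝ^{d×d}, B ∈ ℝ^{d×p}. Agent 1 is the leader and agents 2,…,N are followers. Let l_{ik} ∈ {0,1} for i,k ∈ {2,…,N} with l_{ii} = 0 and l_{ik} = l_{ki}, and let l_{i1} ∈ {0,1} for i ∈ {2,…,N}; assume the undirected graph on {1,…,N} with an edge {i,k} (i,k ≥ 2) whenever l_{ik} = 1 and an edge {1,i} whenever l_{i1} = 1 is connected. Let Q ∈ ℝ^{d×d} be symmetric positive definite, let γ_l > 0, and suppose R ∈ ℝ^{d×d} is symmetric positive definite with RA + AᵀR − γ_l RBBᵀR + 3Q negative semidefinite. Set K_u = BᵀR and K_w = RBBᵀR. Let x_1,…,x_N : ℝ → ℝ^d and w_{i1} : ℝ → ℝ (i = 2,…,N) be differentiable and satisfy, for all t ≥ 0: ẋ_1(t) = A x_1(t); ẋ_i(t) = A x_i(t) + B( l_{i1} w_{i1}(t) K_u (x_1(t) − x_i(t)) + K_u ∑_{k=2,…,N, k≠i} l_{ik}(x_k(t) − x_i(t)) ) for i ≥ 2; ẇ_{i1}(t)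 = (x_1(t) − x_i(t))ᵀ K_w (x_1(t) − x_i(t)); w_{i1}(0) = 1; and each w_{i1} is bounded above on [0,∞). Then (i) for every i ≥ 2, x_i(t) − x_1(t) → 0 as t → +∞, and (ii) each function t ↦ (x_i(t) − x_1(t))ᵀ RBBᵀR (x_i(t) − x_1(t)) is integrable on [0,∞) and ∑_{i=2}^N ∫_0^∞ l_{i1}(x_1 − x_i)ᵀQ(x_1 − x_i) dt + (1/(N−1)) ∑_{i=2}^N ∑_{k=2}^N ∫_0^∞ (x_k − x_i)ᵀQ(x_k − x_i) dt ≤ ∑_{i=2}^N (x_i(0) − x_1(0))ᵀ R (x_i(0) − x_1(0)) + γ_l ∫_0^∞ ∑_{i=2}^N (x_i(t) − x_1(t))ᵀ RBBᵀR (x_i(t) − x_1(t)) dt. -/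

import Mathlib

open Matrix MeasureTheory Filter

/-- A differentiable function on `[0, ∞)` with nonnegative derivative that is bounded above
converges at infinity. -/
lemma exists_tendsto_atTop_of_hasDerivAt_nonneg {f f' : ℝ → ℝ} {C : ℝ}
    (hf : ∀ t, 0 ≤ t → HasDerivAt f (f' t) t) (hf' : ∀ t, 0 ≤ t → 0 ≤ f' t)
    (hC : ∀ t, 0 ≤ t → f t ≤ C) : ∃ L, Tendsto f atTop (nhds L) := by
  have hmono : MonotoneOn f (Set.Ici 0) := by
    refine monotoneOn_of_deriv_nonneg (convex_Ici 0)
      (fun t ht => (hf t ht).continuousAt.continuousWithinAt) ?_ ?_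
    · intro t ht
      rw [interior_Ici] at ht
      exact (hf t ht.le).differentiableAt.differentiableWithinAt
    · intro t ht
      rw [interior_Ici] at ht
      rw [(hf t ht.le).deriv]
      exact hf' t ht.le
  have hm : Monotone fun t => f (max t 0) := fun s t hst =>
    hmono (le_max_right s 0) (le_max_right t 0) (max_le_max_right 0 hst)
  have hb : BddAbove (Set.range fun t => f (max t 0)) :=
    ⟨C, by rintro _ ⟨t, rfl⟩; exact hC _ (le_max_right t 0)⟩
  refine ⟨_, (tendsto_atTop_ciSup hm hb).congr' ?_⟩
  filter_upwards [eventually_ge_atTop 0] with t ht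
  rw [max_eq_left ht]

lemma HasDerivAt.dotProduct_mulVec_self {n : Type*} [Fintype n] {M : Matrix n n ℝ}
    (hM : Mᵀ = M) {f : ℝ → n → ℝ} {f' : n → ℝ} {t : ℝ} (hf : HasDerivAt f f' t) :
    HasDerivAt (fun s => f s ⬝ᵥ M.mulVec (f s)) (2 * (f t ⬝ᵥ M.mulVec f')) t := by
  have hc := hasDerivAt_pi.1 hf
  have h : HasDerivAt (fun s => ∑ i, f s i * ∑ j, M i j * f s j)
      (∑ i, (f' i * (∑ j, M i j * f t j) + f t i * ∑ j, M i j * f' j)) t :=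
    HasDerivAt.fun_sum fun i _ => (hc i).mul
      (HasDerivAt.fun_sum fun j _ => (hc j).const_mul (M i j))
  have hsymm : f' ⬝ᵥ M.mulVec (f t) = f t ⬝ᵥ M.mulVec f' := by
    rw [dotProduct_mulVec, ← mulVec_transpose, hM, dotProduct_comm]
  refine h.congr_deriv ?_
  rw [Finset.sum_add_distrib, two_mul]
  nth_rewrite 1 [← hsymm]
  rfl

lemma continuous_dotProduct_mulVec_self {n : Type*} [Fintype n] (M : Matrix n n ℝ) :
    Continuous fun v : n → ℝ => v ⬝ᵥ M.mulVec v := by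
  simp only [dotProduct, mulVec]
  fun_prop

/-- Every quadratic form is dominated by a multiple of a positive definite one. -/
lemma Matrix.PosDef.exists_dotProduct_mulVec_le {n : Type*} [Fintype n] {Q : Matrix n n ℝ}
    (hQ : Q.PosDef) (M : Matrix n n ℝ) :
    ∃ c, 0 ≤ c ∧ ∀ v : n → ℝ, v ⬝ᵥ M.mulVec v ≤ c * (v ⬝ᵥ Q.mulVec v) := by
  have hpos : ∀ v : n → ℝ, v ≠ 0 → 0 < v ⬝ᵥ Q.mulVec v := fun v hv => by
    simpa using hQ.dotProduct_mulVec_pos hv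
  have hcont : ContinuousOn (fun v : n → ℝ => (v ⬝ᵥ M.mulVec v) / (v ⬝ᵥ Q.mulVec v))
      (Metric.sphere 0 1) :=
    (continuous_dotProduct_mulVec_self M).continuousOn.div
      (continuous_dotProduct_mulVec_self Q).continuousOn
      fun v hv => (hpos v (Metric.ne_of_mem_sphere hv one_ne_zero)).ne'
  obtain ⟨c, hc⟩ := (isCompact_sphere (0 : n → ℝ) 1).bddAbove_image hcont
  refine ⟨max c 0, le_max_right c 0, fun v => ?_⟩
  rcases eq_or_ne v 0 with rfl | hv
  · simp
  have hn : ‖v‖ ≠ 0 := norm_ne_zero_iff.2 hv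
  have hmem : ‖v‖⁻¹ • v ∈ Metric.sphere (0 : n → ℝ) 1 := by
    simp [norm_smul, hn]
  have h := hc (Set.mem_image_of_mem _ hmem)
  simp only [mulVec_smul, dotProduct_smul, smul_dotProduct, smul_eq_mul] at h
  rw [mul_div_mul_left _ _ (inv_ne_zero hn), mul_div_mul_left _ _ (inv_ne_zero hn),
    div_le_iff₀ (hpos v hv)] at h
  exact h.trans (mul_le_mul_of_nonneg_right (le_max_left c 0) (hpos v hv).le)

lemma dotProduct_mulVec_sub_le {n : Type*} [Fintype n] {Q : Matrix n n ℝ}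
    (hQ : Q.PosSemidef) (u v : n → ℝ) :
    (u - v) ⬝ᵥ Q.mulVec (u - v) ≤ 2 * (u ⬝ᵥ Q.mulVec u) + 2 * (v ⬝ᵥ Q.mulVec v) := by
  have h := hQ.dotProduct_mulVec_nonneg (u + v)
  simp only [star_trivial, mulVec_add, mulVec_sub, dotProduct_add, dotProduct_sub,
    add_dotProduct, sub_dotProduct] at h ⊢
  linarith

lemma sum_sum_dotProduct_mulVec_sub_le {ι n : Type*} [Fintype n] {Q : Matrix n n ℝ}
    (hQ : Q.PosSemidef) (s : Finset ι) (v : ι → n → ℝ) :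
    ∑ i ∈ s, ∑ k ∈ s, (v k - v i) ⬝ᵥ Q.mulVec (v k - v i) ≤
      2 * s.card * ∑ i ∈ s, v i ⬝ᵥ Q.mulVec (v i) := by
  have h := hQ.dotProduct_mulVec_nonneg (∑ i ∈ s, v i)
  have h' : 0 ≤ ∑ i ∈ s, ∑ k ∈ s, v i ⬝ᵥ Q.mulVec (v k) := by
    rw [Finset.sum_comm]
    simpa [mulVec_sum, sum_dotProduct, dotProduct_sum] using h
  have h'' : ∑ i ∈ s, ∑ k ∈ s, v k ⬝ᵥ Q.mulVec (v i) =
      ∑ i ∈ s, ∑ k ∈ s, v i ⬝ᵥ Q.mulVec (v k) := Finset.sum_comm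
  simp only [mulVec_sub, dotProduct_sub, sub_dotProduct, Finset.sum_sub_distrib,
    Finset.sum_const, nsmul_eq_mul, ← Finset.mul_sum]
  linarith

/-- Symmetric diffusive coupling is dissipative. -/
lemma sum_sum_mul_dotProduct_sub_nonpos {ι n : Type*} [Fintype n] (s : Finset ι)
    {l : ι → ι → ℝ} (hl : ∀ i ∈ s, ∀ k ∈ s, 0 ≤ l i k) (hsymm : ∀ i ∈ s, ∀ k ∈ s, l i k = l k i)
    (y : ι → n → ℝ) : ∑ i ∈ s, ∑ k ∈ s, l i k * (y i ⬝ᵥ (y k - y i)) ≤ 0 := by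
  have hswap : ∑ i ∈ s, ∑ k ∈ s, l i k * (y i ⬝ᵥ (y k - y i)) =
      ∑ i ∈ s, ∑ k ∈ s, l i k * (y k ⬝ᵥ (y i - y k)) := by
    rw [Finset.sum_comm]
    exact Finset.sum_congr rfl fun i hi => Finset.sum_congr rfl fun k hk => by
      rw [hsymm k hk i hi]
  have hsum : ∑ i ∈ s, ∑ k ∈ s, l i k * (y i ⬝ᵥ (y k - y i)) +
      ∑ i ∈ s, ∑ k ∈ s, l i k * (y k ⬝ᵥ (y i - y k)) ≤ 0 := by
    simp only [← Finset.sum_add_distrib]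
    refine Finset.sum_nonpos fun i hi => Finset.sum_nonpos fun k hk => ?_
    have hnn : 0 ≤ (y k - y i) ⬝ᵥ (y k - y i) := by
      simpa using dotProduct_star_self_nonneg (y k - y i)
    have hmul := mul_nonneg (hl i hi k hk) hnn
    have he : l i k * (y i ⬝ᵥ (y k - y i)) + l i k * (y k ⬝ᵥ (y i - y k)) =
        -(l i k * ((y k - y i) ⬝ᵥ (y k - y i))) := by
      simp only [dotProduct_sub, sub_dotProduct]
      ring
    linarith
  linarith

lemma dotProduct_mul_mul_transpose_mul_mulVec_self {n p : Type*} [Fintype n] [Fintype p]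
    {R : Matrix n n ℝ} (hR : Rᵀ = R) (B : Matrix n p ℝ) (v : n → ℝ) :
    v ⬝ᵥ (R * B * Bᵀ * R).mulVec v = (Bᵀ * R).mulVec v ⬝ᵥ (Bᵀ * R).mulVec v := by
  rw [Matrix.mul_assoc, ← mulVec_mulVec, dotProduct_mulVec, ← mulVec_transpose,
    transpose_mul, hR]

lemma two_mul_dotProduct_mulVec_add {n p : Type*} [Fintype n] [Fintype p]
    {R : Matrix n n ℝ} (hR : Rᵀ = R) (A : Matrix n n ℝ) (B : Matrix n p ℝ) (v : n → ℝ)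
    (z : p → ℝ) :
    2 * (v ⬝ᵥ R.mulVec (A.mulVec v + B.mulVec z)) =
      v ⬝ᵥ (R * A + Aᵀ * R).mulVec v + 2 * ((Bᵀ * R).mulVec v ⬝ᵥ z) := by
  have h₁ : v ⬝ᵥ (Aᵀ * R).mulVec v = v ⬝ᵥ (R * A).mulVec v := by
    rw [dotProduct_mulVec, ← mulVec_transpose, transpose_mul, hR, transpose_transpose,
      dotProduct_comm]
  have h₂ : v ⬝ᵥ (R * B).mulVec z = (Bᵀ * R).mulVec v ⬝ᵥ z := by
    rw [dotProduct_mulVec, ← mulVec_transpose, transpose_mul, hR]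
  rw [mulVec_add, dotProduct_add, mulVec_mulVec, mulVec_mulVec, add_mulVec, dotProduct_add,
    h₁, h₂]
  ring

/-- Theorem 2 (leader-follower adaptive guaranteed-performance consensualization).
Agents are indexed by `Fin (m + 1)`, with `0` the leader and the remaining `N - 1`
agents the followers.  `w i` is the adaptive weight `w_{i1}` from the leader to
follower `i`. -/
theorem leader_follower_adaptive_guaranteed_performance_consensus
    (m d p : ℕ) (hm : 1 ≤ m) (hd : 0 < d) (hp : 0 < p)
    (A : Matrix (Fin d) (Fin d) ℝ) (B : Matrix (Fin d) (Fin p) ℝ)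
    (l : Fin (m + 1) → Fin (m + 1) → ℝ)
    (hl01 : ∀ i k, l i k = 0 ∨ l i k = 1)
    (hldiag : ∀ i, l i i = 0)
    (hlsymm : ∀ i k, i ≠ 0 → k ≠ 0 → l i k = l k i)
    (hconn : (SimpleGraph.fromRel (fun i k : Fin (m + 1) =>
        (k = 0 ∧ i ≠ 0 ∧ l i 0 = 1) ∨ (i ≠ 0 ∧ k ≠ 0 ∧ l i k = 1))).Connected)
    (Q : Matrix (Fin d) (Fin d) ℝ) (hQ : Q.PosDef)
    (γl : ℝ) (hγl : 0 < γl)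
    (R : Matrix (Fin d) (Fin d) ℝ) (hR : R.PosDef)
    (hRiccati : ∀ v : Fin d → ℝ,
      v ⬝ᵥ (R * A + Aᵀ * R - γl • (R * B * Bᵀ * R) + (3 : ℝ) • Q).mulVec v ≤ 0)
    (Ku : Matrix (Fin p) (Fin d) ℝ) (hKu : Ku = Bᵀ * R)
    (Kw : Matrix (Fin d) (Fin d) ℝ) (hKw : Kw = R * B * Bᵀ * R)
    (x : Fin (m + 1) → ℝ → (Fin d → ℝ)) (w : Fin (m + 1) → ℝ → ℝ)
    (hx : ∀ i, Differentiable ℝ (x i))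
    (hw : ∀ i : Fin (m + 1), i ≠ 0 → Differentiable ℝ (w i))
    (hdynleader : ∀ t : ℝ, 0 ≤ t → HasDerivAt (x 0) (A.mulVec (x 0 t)) t)
    (hdynx : ∀ i : Fin (m + 1), i ≠ 0 → ∀ t : ℝ, 0 ≤ t →
      HasDerivAt (x i)
        (A.mulVec (x i t) +
          B.mulVec ((l i 0 * w i t) • Ku.mulVec (x 0 t - x i t) +
            Ku.mulVec (∑ k ∈ (Finset.univ.erase 0).erase i, l i k • (x k t - x i t)))) t)
    (hdynw : ∀ i : Fin (m + 1), i ≠ 0 → ∀ t : ℝ, 0 ≤ t →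
      HasDerivAt (w i) ((x 0 t - x i t) ⬝ᵥ Kw.mulVec (x 0 t - x i t)) t)
    (hw0 : ∀ i : Fin (m + 1), i ≠ 0 → w i 0 = 1)
    (hwbdd : ∀ i : Fin (m + 1), i ≠ 0 → ∃ C : ℝ, ∀ t : ℝ, 0 ≤ t → w i t ≤ C) :
    (∀ i : Fin (m + 1), i ≠ 0 → Tendsto (fun t => x i t - x 0 t) atTop (nhds 0)) ∧
    (∀ i : Fin (m + 1), i ≠ 0 → IntegrableOn
      (fun t => (x i t - x 0 t) ⬝ᵥ (R * B * Bᵀ * R).mulVec (x i t - x 0 t))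
      (Set.Ici (0 : ℝ))) ∧
    (∀ i k : Fin (m + 1), IntegrableOn
      (fun t => (x k t - x i t) ⬝ᵥ Q.mulVec (x k t - x i t)) (Set.Ici (0 : ℝ))) ∧
    (∑ i ∈ Finset.univ.erase (0 : Fin (m + 1)),
        ∫ t in Set.Ici (0 : ℝ), l i 0 * ((x 0 t - x i t) ⬝ᵥ Q.mulVec (x 0 t - x i t))) +
      (m : ℝ)⁻¹ * ∑ i ∈ Finset.univ.erase (0 : Fin (m + 1)),
        ∑ k ∈ Finset.univ.erase (0 : Fin (m + 1)),
          ∫ t in Set.Ici (0 : ℝ), (x k t - x i t) ⬝ᵥ Q.mulVec (x k t - x i t) ≤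
    (∑ i ∈ Finset.univ.erase (0 : Fin (m + 1)),
        (x i 0 - x 0 0) ⬝ᵥ R.mulVec (x i 0 - x 0 0)) +
      γl * ∫ t in Set.Ici (0 : ℝ), ∑ i ∈ Finset.univ.erase (0 : Fin (m + 1)),
        (x i t - x 0 t) ⬝ᵥ (R * B * Bᵀ * R).mulVec (x i t - x 0 t) := by
  have hRs : Rᵀ = R := by simpa using hR.isHermitian.eq
  set F := Finset.univ.erase (0 : Fin (m + 1)) with hF
  have hF0 : ∀ i ∈ F, i ≠ 0 := fun i hi => Finset.ne_of_mem_erase hi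
  have hcard : (F.card : ℝ) = m := by simp [hF]
  have hl0 : ∀ i k, 0 ≤ l i k := fun i k => by rcases hl01 i k with h | h <;> simp [h]
  have hl1 : ∀ i k, l i k ≤ 1 := fun i k => by rcases hl01 i k with h | h <;> simp [h]
  have hQnn : ∀ v : Fin d → ℝ, 0 ≤ v ⬝ᵥ Q.mulVec v := fun v => by
    simpa using hQ.posSemidef.dotProduct_mulVec_nonneg v
  have hRnn : ∀ v : Fin d → ℝ, 0 ≤ v ⬝ᵥ R.mulVec v := fun v => by
    simpa using hR.posSemidef.dotProduct_mulVec_nonneg v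
  set e : Fin (m + 1) → ℝ → Fin d → ℝ := fun i t => x i t - x 0 t with he
  have hxe : ∀ i k t, x k t - x i t = e k t - e i t := fun i k t => by simp [he]
  have hec : ∀ i, Continuous (e i) := fun i => (hx i).continuous.sub (hx 0).continuous
  set g : Fin (m + 1) → ℝ → ℝ := fun i t => e i t ⬝ᵥ (R * B * Bᵀ * R).mulVec (e i t) with hg
  set q : Fin (m + 1) → ℝ → ℝ := fun i t => e i t ⬝ᵥ Q.mulVec (e i t) with hq
  have hgy : ∀ i t, g i t = Ku.mulVec (e i t) ⬝ᵥ Ku.mulVec (e i t) := fun i t => by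
    rw [hKu]; exact dotProduct_mul_mul_transpose_mul_mulVec_self hRs B (e i t)
  have hgnn : ∀ i t, 0 ≤ g i t := fun i t => by
    rw [hgy]
    simpa using dotProduct_star_self_nonneg (Ku.mulVec (e i t))
  have hqnn : ∀ i t, 0 ≤ q i t := fun i t => hQnn _
  have hqc : ∀ i, Continuous (q i) := fun i => (continuous_dotProduct_mulVec_self Q).comp (hec i)
  have hneg : ∀ (M : Matrix (Fin d) (Fin d) ℝ) (i : Fin (m + 1)) (t : ℝ),
      (x 0 t - x i t) ⬝ᵥ M.mulVec (x 0 t - x i t) = e i t ⬝ᵥ M.mulVec (e i t) := by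
    intro M i t
    have : x 0 t - x i t = -e i t := by simp [he]
    rw [this, mulVec_neg, neg_dotProduct_neg]
  have hwd : ∀ i ∈ F, ∀ t : ℝ, 0 ≤ t → HasDerivAt (w i) (g i t) t := fun i hi t ht =>
    (hdynw i (hF0 i hi) t ht).congr_deriv (by rw [hneg, hKw])
  have hwlim : ∀ i ∈ F, ∃ L, Tendsto (w i) atTop (nhds L) := fun i hi => by
    obtain ⟨C, hC⟩ := hwbdd i (hF0 i hi)
    exact exists_tendsto_atTop_of_hasDerivAt_nonneg (hwd i hi) (fun t _ => hgnn i t) hC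
  have hw1 : ∀ i ∈ F, ∀ t, 0 ≤ t → 0 ≤ w i t := fun i hi t ht => by
    have hmono : MonotoneOn (w i) (Set.Ici 0) := by
      refine monotoneOn_of_deriv_nonneg (convex_Ici 0)
        (hw i (hF0 i hi)).continuous.continuousOn (hw i (hF0 i hi)).differentiableOn ?_
      intro s hs
      rw [interior_Ici] at hs
      rw [(hwd i hi s hs.le).deriv]
      exact hgnn i s
    have := hmono Set.self_mem_Ici ht ht
    rw [hw0 i (hF0 i hi)] at this
    linarith
  choose! Lw hLw using hwlim
  have hgint : ∀ i ∈ F, IntegrableOn (g i) (Set.Ioi 0) := fun i hi =>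
    integrableOn_Ioi_deriv_of_nonneg' (fun t ht => hwd i hi t ht) (fun t _ => hgnn i t) (hLw i hi)
  have hgval : ∀ i ∈ F, ∫ t in Set.Ioi 0, g i t = Lw i - 1 := fun i hi => by
    rw [← hw0 i (hF0 i hi)]
    exact integral_Ioi_of_hasDerivAt_of_nonneg' (fun t ht => hwd i hi t ht)
      (fun t _ => hgnn i t) (hLw i hi)
  set e' : Fin (m + 1) → ℝ → Fin d → ℝ := fun i t => A.mulVec (e i t) +
    B.mulVec (-((l i 0 * w i t) • Ku.mulVec (e i t)) +
      ∑ k ∈ F, l i k • (Ku.mulVec (e k t) - Ku.mulVec (e i t))) with he'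
  have hed : ∀ i ∈ F, ∀ t : ℝ, 0 ≤ t → HasDerivAt (e i) (e' i t) t := fun i hi t ht => by
    refine ((hdynx i (hF0 i hi) t ht).sub (hdynleader t ht)).congr_deriv ?_
    have h₁ : x 0 t - x i t = -e i t := by simp [he]
    have h₂ : ∑ k ∈ F.erase i, l i k • (x k t - x i t) =
        ∑ k ∈ F, l i k • (e k t - e i t) := by
      rw [Finset.sum_erase _ (by simp [hldiag])]
      simp only [hxe]
    rw [h₂, h₁, mulVec_sum]
    simp only [he', mulVec_smul, mulVec_sub, mulVec_neg, smul_neg]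
    have h₃ : A.mulVec (e i t) = A.mulVec (x i t) - A.mulVec (x 0 t) := by
      simp only [he, mulVec_sub]
    rw [h₃]
    abel
  set V : ℝ → ℝ := fun t => ∑ i ∈ F, e i t ⬝ᵥ R.mulVec (e i t) with hV
  set V' : ℝ → ℝ := fun t => ∑ i ∈ F, 2 * (e i t ⬝ᵥ R.mulVec (e' i t)) with hV'
  have hVd : ∀ t, 0 ≤ t → HasDerivAt V (V' t) t := fun t ht =>
    HasDerivAt.fun_sum fun i hi => (hed i hi t ht).dotProduct_mulVec_self hRs
  have hVnn : ∀ t, 0 ≤ V t := fun t => Finset.sum_nonneg fun i _ => hRnn _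
  have hV'le : ∀ t, 0 ≤ t → V' t ≤ ∑ i ∈ F, (γl * g i t - 3 * q i t) := fun t ht => by
    have hcouple := sum_sum_mul_dotProduct_sub_nonpos F (l := l) (fun i _ k _ => hl0 i k)
      (fun i hi k hk => hlsymm i k (hF0 i hi) (hF0 k hk)) (fun i => Ku.mulVec (e i t))
    have hterm : ∀ i ∈ F, 2 * (e i t ⬝ᵥ R.mulVec (e' i t)) ≤ (γl * g i t - 3 * q i t) +
        2 * ∑ k ∈ F, l i k *
          (Ku.mulVec (e i t) ⬝ᵥ (Ku.mulVec (e k t) - Ku.mulVec (e i t))) := fun i hi => by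
      have hr := hRiccati (e i t)
      have hnn := mul_nonneg (mul_nonneg (hl0 i 0) (hw1 i hi t ht)) (hgnn i t)
      rw [add_mulVec, sub_mulVec, dotProduct_add, dotProduct_sub, smul_mulVec, smul_mulVec,
        dotProduct_smul, dotProduct_smul, smul_eq_mul, smul_eq_mul] at hr
      rw [two_mul_dotProduct_mulVec_add hRs, ← hKu, dotProduct_add, dotProduct_neg,
        dotProduct_smul, ← hgy, dotProduct_sum]
      simp only [dotProduct_smul, smul_eq_mul]
      change _ - γl * g i t + 3 * q i t ≤ 0 at hr
      linarith
    refine (Finset.sum_le_sum hterm).trans ?_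
    rw [Finset.sum_add_distrib, ← Finset.mul_sum]
    linarith
  set S : ℝ → ℝ := fun t => ∑ i ∈ F, q i t with hS
  have hSnn : ∀ t, 0 ≤ S t := fun t => Finset.sum_nonneg fun i _ => hqnn i t
  have hSc : Continuous S := continuous_finsetSum _ fun i _ => hqc i
  set U : ℝ → ℝ := fun t => γl * ∑ i ∈ F, w i t - V t with hU
  set U' : ℝ → ℝ := fun t => γl * ∑ i ∈ F, g i t - V' t with hU'
  have hUd : ∀ t, 0 ≤ t → HasDerivAt U (U' t) t := fun t ht =>
    ((HasDerivAt.fun_sum fun i hi => hwd i hi t ht).const_mul γl).sub (hVd t ht)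
  have hU'S : ∀ t, 0 ≤ t → 3 * S t ≤ U' t := fun t ht => by
    have := hV'le t ht
    rw [Finset.sum_sub_distrib, ← Finset.mul_sum, ← Finset.mul_sum] at this
    simp only [hU', hS]
    linarith
  have hU'nn : ∀ t, 0 ≤ t → 0 ≤ U' t := fun t ht => by
    have := hSnn t
    have := hU'S t ht
    linarith
  have hwsum : Tendsto (fun t => γl * ∑ i ∈ F, w i t) atTop (nhds (γl * ∑ i ∈ F, Lw i)) :=
    (tendsto_finsetSum F hLw).const_mul γl
  choose! C hC using hwbdd
  obtain ⟨LU, hLU⟩ := exists_tendsto_atTop_of_hasDerivAt_nonneg (C := γl * ∑ i ∈ F, C i)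
    hUd hU'nn fun t ht => by
      have h₁ : γl * ∑ i ∈ F, w i t ≤ γl * ∑ i ∈ F, C i :=
        mul_le_mul_of_nonneg_left (Finset.sum_le_sum fun i hi => hC i (hF0 i hi) t ht) hγl.le
      have h₂ := hVnn t
      simp only [hU]
      linarith
  have hVlim : Tendsto V atTop (nhds (γl * ∑ i ∈ F, Lw i - LU)) :=
    (hwsum.sub hLU).congr fun t => by simp [hU]
  have hU'int : IntegrableOn U' (Set.Ioi 0) :=
    integrableOn_Ioi_deriv_of_nonneg' (fun t ht => hUd t ht) (fun t ht => hU'nn t ht.le) hLU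
  have hU'val : ∫ t in Set.Ioi 0, U' t = LU - U 0 :=
    integral_Ioi_of_hasDerivAt_of_nonneg' (fun t ht => hUd t ht) (fun t ht => hU'nn t ht.le) hLU
  have hSint : IntegrableOn S (Set.Ioi 0) := by
    refine hU'int.mono' hSc.aestronglyMeasurable
      ((ae_restrict_iff' measurableSet_Ioi).2 (.of_forall fun t ht => ?_))
    rw [Real.norm_of_nonneg (hSnn t)]
    have := hSnn t
    have := hU'S t (le_of_lt ht)
    linarith
  have he0 : ∀ t, e 0 t = 0 := fun t => by simp [he]
  have hqS : ∀ i t, q i t ≤ S t := fun i t => by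
    rcases eq_or_ne i 0 with rfl | hi
    · simpa [hq, he0] using hSnn t
    · exact Finset.single_le_sum (f := fun i => q i t) (fun i _ => hqnn i t)
        (Finset.mem_erase.2 ⟨hi, Finset.mem_univ i⟩)
  have hqint : ∀ i, IntegrableOn (q i) (Set.Ioi 0) := fun i =>
    hSint.mono' (hqc i).aestronglyMeasurable (.of_forall fun t => by
      rw [Real.norm_of_nonneg (hqnn i t)]
      exact hqS i t)
  have hpint : ∀ i k, IntegrableOn (fun t => (e k t - e i t) ⬝ᵥ Q.mulVec (e k t - e i t))
      (Set.Ioi 0) := fun i k => by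
    refine (((hqint k).const_mul 2).add ((hqint i).const_mul 2)).mono'
      ((continuous_dotProduct_mulVec_self Q).comp
        ((hec k).sub (hec i))).aestronglyMeasurable (.of_forall fun t => ?_)
    rw [Real.norm_of_nonneg (hQnn _)]
    exact dotProduct_mulVec_sub_le hQ.posSemidef (e k t) (e i t)
  have hVzero : Tendsto V atTop (nhds 0) := by
    obtain ⟨c, -, hc⟩ := hQ.exists_dotProduct_mulVec_le R
    have hVint : IntegrableOn V (Set.Ioi 0) := by
      refine (hSint.const_mul c).mono'
        (continuous_finsetSum _ fun i _ =>
          (continuous_dotProduct_mulVec_self R).comp (hec i)).aestronglyMeasurable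
        (.of_forall fun t => ?_)
      rw [Real.norm_of_nonneg (hVnn t)]
      simp only [hV, hS, Finset.mul_sum]
      exact Finset.sum_le_sum fun i _ => hc (e i t)
    have hz : γl * ∑ i ∈ F, Lw i - LU = 0 := by
      refine IntegrableAtFilter.eq_zero_of_tendsto (μ := volume)
        ⟨Set.Ioi 0, Ioi_mem_atTop 0, hVint⟩ ?_ hVlim
      intro s hs
      obtain ⟨b, hb⟩ := mem_atTop_sets.1 hs
      rw [← top_le_iff, ← Real.volume_Ici (a := b)]
      exact measure_mono hb
    rwa [hz] at hVlim
  refine ⟨fun i hi => ?_, fun i hi => ?_, fun i k => ?_, ?_⟩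
  · have hiF : i ∈ F := Finset.mem_erase.2 ⟨hi, Finset.mem_univ i⟩
    obtain ⟨c, hc0, hc⟩ := hR.exists_dotProduct_mulVec_le (1 : Matrix (Fin d) (Fin d) ℝ)
    rw [tendsto_pi_nhds]
    intro j
    have hsq : Tendsto (fun t => e i t j ^ 2) atTop (nhds 0) := by
      refine squeeze_zero (fun t => sq_nonneg _) (fun t => ?_)
        (by simpa using hVzero.const_mul c)
      have h₁ : e i t j ^ 2 ≤ e i t ⬝ᵥ e i t := by
        rw [sq]
        exact Finset.single_le_sum (f := fun j => e i t j * e i t j)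
          (fun j _ => mul_self_nonneg _) (Finset.mem_univ j)
      have h₂ := hc (e i t)
      rw [one_mulVec] at h₂
      exact h₁.trans (h₂.trans (mul_le_mul_of_nonneg_left
        (Finset.single_le_sum (f := fun i => e i t ⬝ᵥ R.mulVec (e i t))
          (fun i _ => hRnn _) hiF) hc0))
    refine (tendsto_zero_iff_abs_tendsto_zero _).2 ?_
    have habs := hsq.sqrt
    simp only [Real.sqrt_sq_eq_abs, Real.sqrt_zero] at habs
    exact habs
  · exact (integrableOn_Ici_iff_integrableOn_Ioi (by simp)).2
      (hgint i (Finset.mem_erase.2 ⟨hi, Finset.mem_univ i⟩))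
  · simp only [hxe]
    exact (integrableOn_Ici_iff_integrableOn_Ioi (by simp)).2 (hpint i k)
  · simp only [integral_Ici_eq_integral_Ioi, hxe, he0, zero_sub, sub_zero, mulVec_neg,
      neg_dotProduct_neg]
    have hSval : ∫ t in Set.Ioi 0, S t = ∑ i ∈ F, ∫ t in Set.Ioi 0, q i t :=
      integral_finsetSum F fun i _ => hqint i
    have hlead : ∑ i ∈ F, ∫ t in Set.Ioi 0, l i 0 * q i t ≤ ∫ t in Set.Ioi 0, S t := by
      rw [hSval]
      refine Finset.sum_le_sum fun i _ => ?_
      rw [integral_const_mul]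
      exact mul_le_of_le_one_left (integral_nonneg fun t => hqnn i t) (hl1 i 0)
    have hpair : (m : ℝ)⁻¹ * ∑ i ∈ F, ∑ k ∈ F,
        ∫ t in Set.Ioi 0, (e k t - e i t) ⬝ᵥ Q.mulVec (e k t - e i t) ≤
          2 * ∫ t in Set.Ioi 0, S t := by
      have hm0 : (0 : ℝ) < m := by exact_mod_cast hm
      rw [inv_mul_le_iff₀ hm0]
      simp_rw [← integral_finsetSum F fun k _ => hpint _ k]
      rw [← integral_finsetSum F fun i _ => integrable_finsetSum F fun k _ => hpint i k,
        ← integral_const_mul, ← integral_const_mul]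
      refine integral_mono
        (integrable_finsetSum F fun i _ => integrable_finsetSum F fun k _ => hpint i k)
        ((hSint.const_mul 2).const_mul _) fun t => ?_
      have h := sum_sum_dotProduct_mulVec_sub_le hQ.posSemidef F fun i => e i t
      rw [hcard] at h
      refine h.trans (le_of_eq ?_)
      simp only [hS, hq]
      ring
    have hmain : 3 * ∫ t in Set.Ioi 0, S t ≤ LU - U 0 := by
      rw [← hU'val, ← integral_const_mul]
      exact setIntegral_mono_on (hSint.const_mul 3) hU'int measurableSet_Ioi
        fun t ht => hU'S t (le_of_lt ht)
    have hgsum : ∫ t in Set.Ioi 0, ∑ i ∈ F, g i t = ∑ i ∈ F, Lw i - ∑ i ∈ F, w i 0 := by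
      rw [integral_finsetSum F hgint, ← Finset.sum_sub_distrib]
      exact Finset.sum_congr rfl fun i hi => by rw [hgval i hi, hw0 i (hF0 i hi)]
    have hLUeq : γl * ∑ i ∈ F, Lw i - LU = 0 := tendsto_nhds_unique hVlim hVzero
    change _ ≤ V 0 + γl * ∫ t in Set.Ioi 0, ∑ i ∈ F, g i t
    rw [hgsum]
    simp only [hU] at hmain
    linarith
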